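/- arXiv:1909.01330 — 6 statements merged into one kernel-verified Lean document; each statement's English description precedes it below -/
import Mathlib

section
/- The first-order scheme obtained from the integral form of the spatial SIR model preserves the qualitative properties under the step-size restriction 0 < τ ≤ 1/b: let b > 0, c ≥ 0, τ > 0 with τ·b ≤ 1, and let S⁰, I⁰, R⁰ : ℝ² → ℝ be nonnegative bounded measurable functions vanishing outside Ω. Define recursively, for n ≥ 1 and every (x, y): Sⁿ(x,y) = Sⁿ⁻¹(x,y)·exp(−τ·(𝓕Iⁿ⁻¹)(x,y) − c·τ), Rⁿ(x,y) = Rⁿ⁻¹(x,y) + b·τ·Iⁿ⁻¹(x,y) + c·τ·Sⁿ(x,y), and Iⁿ(x,y) = (Sⁿ⁻¹ + Iⁿ⁻¹ + Rⁿ⁻¹)(x,y) − Sⁿ(x,y) − Rⁿ(x,y). Then for every n ≥ 1 and every (x, y): Sⁿ, Iⁿ, Rⁿ are nonnegative; Sⁿ + Iⁿ + Rⁿ = S⁰ + I⁰ + R⁰; Sⁿ ≤ Sⁿ⁻¹; and Rⁿ ≥ Rⁿ⁻¹. -/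
open MeasureTheory

/-- The integral operator `𝓕`. -/
noncomputable def calF (g₁ g₂ : ℝ → ℝ) (δ : ℝ) (u : ℝ × ℝ → ℝ) (p : ℝ × ℝ) : ℝ :=
  ∫ r in Set.Icc (0 : ℝ) δ, ∫ θ in Set.Icc (0 : ℝ) (2 * Real.pi),
    g₁ r * g₂ θ * u (p.1 + r * Real.cos θ, p.2 + r * Real.sin θ) * r

/-- The first-order scheme obtained from the integral form of the spatial SIR model
preserves nonnegativity, conservation of the total population, monotonicity of `S`
and of `R`, under the step-size restriction `0 < τ ≤ 1/b`. -/
theorem integral_scheme_qualitative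
    (Ω : Set (ℝ × ℝ)) (hΩmeas : MeasurableSet Ω) (hΩbdd : Bornology.IsBounded Ω)
    (hΩpos : 0 < volume Ω)
    (δ : ℝ) (hδ : 0 < δ)
    (g₁ g₂ : ℝ → ℝ) (hg₁meas : Measurable g₁) (hg₂meas : Measurable g₂)
    (hg₁nn : ∀ r ∈ Set.Icc (0 : ℝ) δ, 0 ≤ g₁ r)
    (hg₂nn : ∀ θ ∈ Set.Icc (0 : ℝ) (2 * Real.pi), 0 ≤ g₂ θ)
    (hg₁bdd : ∃ κ₁, ∀ r ∈ Set.Icc (0 : ℝ) δ, g₁ r ≤ κ₁)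
    (hg₂bdd : ∃ κ₂, ∀ θ ∈ Set.Icc (0 : ℝ) (2 * Real.pi), g₂ θ ≤ κ₂)
    (b c τ : ℝ) (hb : 0 < b) (hc : 0 ≤ c) (hτ : 0 < τ) (hτb : τ * b ≤ 1)
    (S I R : ℕ → ℝ × ℝ → ℝ)
    (hS0nn : ∀ p, 0 ≤ S 0 p) (hI0nn : ∀ p, 0 ≤ I 0 p) (hR0nn : ∀ p, 0 ≤ R 0 p)
    (hS0meas : Measurable (S 0)) (hI0meas : Measurable (I 0)) (hR0meas : Measurable (R 0))
    (h0bdd : ∃ M, ∀ p, S 0 p ≤ M ∧ I 0 p ≤ M ∧ R 0 p ≤ M)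
    (h0supp : ∀ p ∉ Ω, S 0 p = 0 ∧ I 0 p = 0 ∧ R 0 p = 0)
    (hSrec : ∀ n p, S (n + 1) p = S n p * Real.exp (-(τ * calF g₁ g₂ δ (I n) p) - c * τ))
    (hRrec : ∀ n p, R (n + 1) p = R n p + b * τ * I n p + c * τ * S (n + 1) p)
    (hIrec : ∀ n p,
      I (n + 1) p = (S n p + I n p + R n p) - S (n + 1) p - R (n + 1) p) :
    ∀ n p,
      (0 ≤ S (n + 1) p ∧ 0 ≤ I (n + 1) p ∧ 0 ≤ R (n + 1) p) ∧
      S (n + 1) p + I (n + 1) p + R (n + 1) p = S 0 p + I 0 p + R 0 p ∧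
      S (n + 1) p ≤ S n p ∧ R n p ≤ R (n + 1) p := by
  have key : ∀ n, (∀ p, 0 ≤ S n p) → (∀ p, 0 ≤ I n p) → (∀ p, 0 ≤ R n p) → ∀ p,
      (0 ≤ S (n + 1) p ∧ 0 ≤ I (n + 1) p ∧ 0 ≤ R (n + 1) p) ∧
      S (n + 1) p ≤ S n p ∧ R n p ≤ R (n + 1) p := by
    intro n hS hI hR p
    have hF : 0 ≤ calF g₁ g₂ δ (I n) p := by
      unfold calF
      refine setIntegral_nonneg measurableSet_Icc fun r hr => ?_
      refine setIntegral_nonneg measurableSet_Icc fun θ hθ => ?_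
      exact mul_nonneg (mul_nonneg (mul_nonneg (hg₁nn r hr) (hg₂nn θ hθ)) (hI _)) hr.1
    have hcτ : 0 ≤ c * τ := mul_nonneg hc hτ.le
    have hτF := mul_nonneg hτ.le hF
    have hS1 : 0 ≤ S (n + 1) p := by
      rw [hSrec]; exact mul_nonneg (hS p) (Real.exp_pos _).le
    have hbI : 0 ≤ b * τ * I n p := mul_nonneg (mul_nonneg hb.le hτ.le) (hI p)
    have hbI1 : b * τ * I n p ≤ I n p := by nlinarith [hI p]
    have hcS : 0 ≤ c * τ * S (n + 1) p := mul_nonneg hcτ hS1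
    have hkey : S (n + 1) p * (1 + c * τ) ≤ S n p := by
      have h1 : Real.exp (-(τ * calF g₁ g₂ δ (I n) p) - c * τ) * (1 + c * τ) ≤ 1 := by
        calc _ ≤ Real.exp (-(τ * calF g₁ g₂ δ (I n) p) - c * τ) * Real.exp (c * τ) := by
              refine mul_le_mul_of_nonneg_left ?_ (Real.exp_pos _).le
              linarith [Real.add_one_le_exp (c * τ)]
          _ ≤ 1 := by
              rw [← Real.exp_add]
              exact Real.exp_le_one_iff.mpr (by linarith)
      rw [hSrec, mul_assoc]
      exact mul_le_of_le_one_right (hS p) h1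
    have hRr := hRrec n p
    have hIr := hIrec n p
    have hRp := hR p
    refine ⟨⟨hS1, ?_, ?_⟩, ?_, ?_⟩ <;> nlinarith
  have nn : ∀ n, (∀ p, 0 ≤ S n p) ∧ (∀ p, 0 ≤ I n p) ∧ (∀ p, 0 ≤ R n p) := by
    intro n
    induction n with
    | zero => exact ⟨hS0nn, hI0nn, hR0nn⟩
    | succ k ih =>
      have h := key k ih.1 ih.2.1 ih.2.2
      exact ⟨fun p => (h p).1.1, fun p => (h p).1.2.1, fun p => (h p).1.2.2⟩
  have cons : ∀ n p, S n p + I n p + R n p = S 0 p + I 0 p + R 0 p := by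
    intro n p
    induction n with
    | zero => rfl
    | succ k ih => linarith [hIrec k p]
  intro n p
  have h := key n (nn n).1 (nn n).2.1 (nn n).2.2 p
  exact ⟨h.1, cons (n + 1) p, h.2⟩
end

section
/- Qualitative properties of the semi-discretized SIR system: let t_f > 0 and let S, I, R : [0, t_f] → (P → ℝ) be differentiable and satisfy, for every p ∈ P and t ∈ [0, t_f], S_p′(t) = −S_p(t)·(T I(t))(p) − c·S_p(t), I_p′(t) = S_p(t)·(T I(t))(p) − b·I_p(t), R_p′(t) = b·I_p(t) + c·S_p(t), with S_p(0) ≥ 0, I_p(0) ≥ 0, R_p(0) ≥ 0 for all p. Then for every p ∈ P and t ∈ [0, t_f]: S_p(t) ≥ 0, I_p(t) ≥ 0, R_p(t) ≥ 0; S_p(t) + I_p(t) + R_p(t) = S_p(0) + I_p(0) + R_p(0); t ↦ S_p(t) is nonincreasing; and t ↦ R_p(t) is nondecreasing. -/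
/-- The grid functional `(T J)(p) = Σ_q γ(p,q)·J(q)`. -/
def gridT {P : Type*} [Fintype P] (γ : P → P → ℝ) (J : P → ℝ) (p : P) : ℝ :=
  ∑ q, γ p q * J q

lemma hasDerivAt_minsq (x : ℝ) : HasDerivAt (fun y : ℝ => (min y 0)^2) (2 * min x 0) x := by
  rcases lt_trichotomy x 0 with h | h | h
  · have h1 : HasDerivAt (fun y : ℝ => y^2) (2 * x) x := by
      simpa using hasDerivAt_pow 2 x
    rw [min_eq_left h.le]
    refine h1.congr_of_eventuallyEq ?_
    filter_upwards [Iio_mem_nhds h] with y hy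
    rw [min_eq_left (le_of_lt hy)]
  · subst h
    rw [hasDerivAt_iff_isLittleO]
    have h2 : (fun y : ℝ => y^2) =o[nhds 0] (fun y : ℝ => y) := by
      simpa using Asymptotics.isLittleO_pow_pow (𝕜 := ℝ) (m := 1) (n := 2) (by norm_num)
    simp only [min_self, sub_zero, smul_eq_mul, mul_zero]
    norm_num
    refine Asymptotics.IsBigO.trans_isLittleO (Asymptotics.IsBigO.of_bound 1 ?_) h2
    refine Filter.Eventually.of_forall fun y => ?_
    rw [one_mul, Real.norm_eq_abs, Real.norm_eq_abs, abs_of_nonneg (by positivity), abs_of_nonneg (by positivity)]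
    rcases le_total y 0 with hy | hy
    · rw [min_eq_left hy]
    · rw [min_eq_right hy]; nlinarith [sq_nonneg y]
  · have h1 : HasDerivAt (fun y : ℝ => (0:ℝ)) 0 x := hasDerivAt_const x 0
    rw [min_eq_right h.le, mul_zero]
    refine h1.congr_of_eventuallyEq ?_
    filter_upwards [Ioi_mem_nhds h] with y hy
    rw [min_eq_right (le_of_lt hy)]; norm_num

lemma nonneg_of_ineq {P : Type*} [Fintype P] (T : ℝ) (f f' : ℝ → P → ℝ)
    (hf : ∀ p, ∀ t ∈ Set.Icc (0:ℝ) T, HasDerivWithinAt (fun s => f s p) (f' t p) (Set.Icc 0 T) t)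
    (h0 : ∀ p, 0 ≤ f 0 p) (K : P → ℝ)
    (hK : ∀ p, ∀ t ∈ Set.Icc (0:ℝ) T, min (f t p) 0 * f' t p ≤ K p * ∑ q, (min (f t q) 0)^2) :
    ∀ p, ∀ t ∈ Set.Icc (0:ℝ) T, 0 ≤ f t p := by
  set V : ℝ → ℝ := fun t => ∑ q, (min (f t q) 0)^2 with hV
  set L : ℝ := 2 * ∑ p, K p with hL
  have hVd : ∀ t ∈ Set.Icc (0:ℝ) T, HasDerivWithinAt V (∑ q, 2 * min (f t q) 0 * f' t q) (Set.Icc 0 T) t := by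
    intro t ht
    refine HasDerivWithinAt.fun_sum fun q _ => ?_
    exact (hasDerivAt_minsq (f t q)).comp_hasDerivWithinAt t (hf q t ht)
  have hE : ∀ t, HasDerivAt (fun t : ℝ => Real.exp (-(L * t))) (Real.exp (-(L*t)) * (-L)) t := by
    intro t
    have := (((hasDerivAt_id t).const_mul L).neg).exp
    simpa using this
  have hW : ∀ t ∈ Set.Icc (0:ℝ) T, HasDerivWithinAt (fun t => V t * Real.exp (-(L * t)))
      ((∑ q, 2 * min (f t q) 0 * f' t q) * Real.exp (-(L*t)) + V t * (Real.exp (-(L*t)) * (-L))) (Set.Icc 0 T) t :=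
    fun t ht => (hVd t ht).mul (hE t).hasDerivWithinAt
  have hanti : AntitoneOn (fun t => V t * Real.exp (-(L * t))) (Set.Icc 0 T) := by
    refine antitoneOn_of_hasDerivWithinAt_nonpos (convex_Icc 0 T) (fun t ht => (hW t ht).continuousWithinAt)
      (fun t ht => (hW t (interior_subset ht)).mono interior_subset) ?_
    intro t ht
    have ht' := interior_subset ht
    have h1 : (∑ q, 2 * min (f t q) 0 * f' t q) ≤ L * V t := by
      rw [hL, mul_assoc, Finset.sum_mul, Finset.mul_sum]
      refine Finset.sum_le_sum fun q _ => ?_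
      have := hK q t ht'
      simp only [hV]
      linarith
    have := mul_le_mul_of_nonneg_right h1 (Real.exp_pos (-(L*t))).le
    linarith
  intro p t ht
  have hV0 : V 0 = 0 := by
    simp only [hV]
    refine Finset.sum_eq_zero fun q _ => ?_
    rw [min_eq_right (h0 q)]; norm_num
  have h1 := hanti ⟨le_rfl, ht.1.trans ht.2⟩ ht ht.1
  simp only [hV0, zero_mul] at h1
  have h2 : V t ≤ 0 := by
    by_contra hh
    push Not at hh
    have := mul_pos hh (Real.exp_pos (-(L*t)))
    linarith
  have h3 : (min (f t p) 0)^2 ≤ V t :=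
    Finset.single_le_sum (f := fun q => (min (f t q) 0)^2) (fun q _ => sq_nonneg _) (Finset.mem_univ p)
  have h4 : min (f t p) 0 = 0 := by
    have : (min (f t p) 0)^2 = 0 := le_antisymm (h3.trans h2) (sq_nonneg _)
    simpa using this
  exact min_eq_right_iff.mp h4

/-- Qualitative properties of the semi-discretized SIR system: nonnegativity,
conservation of the total population at each grid point, monotone decrease of `S`
and monotone increase of `R`. -/
theorem semidiscrete_SIR_qualitative
    {P : Type*} [Fintype P] [Nonempty P]
    (γ : P → P → ℝ) (hγ : ∀ p q, 0 ≤ γ p q)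
    (b c : ℝ) (hb : 0 < b) (hc : 0 ≤ c)
    (t_f : ℝ) (htf : 0 < t_f)
    (S I R : ℝ → P → ℝ)
    (hSode : ∀ p, ∀ t ∈ Set.Icc (0 : ℝ) t_f,
      HasDerivWithinAt (fun s => S s p) (-(S t p * gridT γ (I t) p) - c * S t p)
        (Set.Icc 0 t_f) t)
    (hIode : ∀ p, ∀ t ∈ Set.Icc (0 : ℝ) t_f,
      HasDerivWithinAt (fun s => I s p) (S t p * gridT γ (I t) p - b * I t p)
        (Set.Icc 0 t_f) t)
    (hRode : ∀ p, ∀ t ∈ Set.Icc (0 : ℝ) t_f,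
      HasDerivWithinAt (fun s => R s p) (b * I t p + c * S t p) (Set.Icc 0 t_f) t)
    (hS0 : ∀ p, 0 ≤ S 0 p) (hI0 : ∀ p, 0 ≤ I 0 p) (hR0 : ∀ p, 0 ≤ R 0 p) :
    ∀ p, ∀ t ∈ Set.Icc (0 : ℝ) t_f,
      (0 ≤ S t p ∧ 0 ≤ I t p ∧ 0 ≤ R t p) ∧
      S t p + I t p + R t p = S 0 p + I 0 p + R 0 p ∧
      (∀ t' ∈ Set.Icc (0 : ℝ) t_f, t' ≤ t → S t p ≤ S t' p ∧ R t' p ≤ R t p) := by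
  have hSc : ∀ p, ContinuousOn (fun s => S s p) (Set.Icc 0 t_f) :=
    fun p t ht => (hSode p t ht).continuousWithinAt
  have hIc : ∀ p, ContinuousOn (fun s => I s p) (Set.Icc 0 t_f) :=
    fun p t ht => (hIode p t ht).continuousWithinAt
  have hTc : ∀ p, ContinuousOn (fun s => gridT γ (I s) p) (Set.Icc 0 t_f) := by
    intro p
    unfold gridT
    exact continuousOn_finsetSum _ fun q _ => continuousOn_const.mul (hIc q)
  have bT : ∀ p, ∃ C, ∀ t ∈ Set.Icc 0 t_f, ‖gridT γ (I t) p‖ ≤ C :=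
    fun p => isCompact_Icc.exists_bound_of_continuousOn (hTc p)
  have bS : ∀ p, ∃ C, ∀ t ∈ Set.Icc 0 t_f, ‖S t p‖ ≤ C :=
    fun p => isCompact_Icc.exists_bound_of_continuousOn (hSc p)
  choose KT hKT using bT
  choose KS hKS using bS
  have z : (0:ℝ) ∈ Set.Icc 0 t_f := ⟨le_rfl, htf.le⟩
  have single : ∀ (J : P → ℝ) (p : P), (min (J p) 0)^2 ≤ ∑ q, (min (J q) 0)^2 := fun J p =>
    Finset.single_le_sum (f := fun q => (min (J q) 0)^2) (fun q _ => sq_nonneg _) (Finset.mem_univ p)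
  have mself : ∀ x : ℝ, min x 0 * x = (min x 0)^2 := by
    intro x
    rcases le_total x 0 with hx | hx
    · rw [min_eq_left hx]; ring
    · rw [min_eq_right hx]; ring
  have hS : ∀ p, ∀ t ∈ Set.Icc (0:ℝ) t_f, 0 ≤ S t p := by
    refine nonneg_of_ineq t_f S _ hSode hS0 KT ?_
    intro p t ht
    have h1 := (abs_le.mp (hKT p t ht)).1
    have h0 : 0 ≤ KT p := (norm_nonneg _).trans (hKT p t ht)
    calc min (S t p) 0 * (-(S t p * gridT γ (I t) p) - c * S t p)
        = (-gridT γ (I t) p - c) * (min (S t p) 0)^2 := by rw [← mself]; ring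
      _ ≤ KT p * (min (S t p) 0)^2 := mul_le_mul_of_nonneg_right (by linarith) (sq_nonneg _)
      _ ≤ _ := mul_le_mul_of_nonneg_left (single (S t) p) h0
  have hI : ∀ p, ∀ t ∈ Set.Icc (0:ℝ) t_f, 0 ≤ I t p := by
    refine nonneg_of_ineq t_f I _ hIode hI0 (fun p => KS p * ∑ q, γ p q) ?_
    intro p t ht
    have h1 := (abs_le.mp (hKS p t ht)).2
    have hs := hS p t ht
    have hV : 0 ≤ ∑ q, (min (I t q) 0)^2 := Finset.sum_nonneg fun q _ => sq_nonneg _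
    have h2 : min (I t p) 0 * gridT γ (I t) p ≤ (∑ q, γ p q) * ∑ q, (min (I t q) 0)^2 := by
      unfold gridT
      rw [Finset.mul_sum, Finset.sum_mul]
      refine Finset.sum_le_sum fun q _ => ?_
      have h3 : min (I t p) 0 * I t q ≤ ∑ q, (min (I t q) 0)^2 := by
        have h4 : min (I t p) 0 * I t q ≤ min (I t p) 0 * min (I t q) 0 :=
          mul_le_mul_of_nonpos_left (min_le_left _ _) (min_le_right _ _)
        have := single (I t) p
        have := single (I t) q
        nlinarith [sq_nonneg (min (I t p) 0 - min (I t q) 0)]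
      have := mul_le_mul_of_nonneg_left h3 (hγ p q)
      linarith
    have h5 : 0 ≤ (∑ q, γ p q) * ∑ q, (min (I t q) 0)^2 :=
      mul_nonneg (Finset.sum_nonneg fun q _ => hγ p q) hV
    calc min (I t p) 0 * (S t p * gridT γ (I t) p - b * I t p)
        = S t p * (min (I t p) 0 * gridT γ (I t) p) - b * (min (I t p) 0)^2 := by
          rw [← mself]; ring
      _ ≤ S t p * (min (I t p) 0 * gridT γ (I t) p) := by
          have := mul_nonneg hb.le (sq_nonneg (min (I t p) 0)); linarith
      _ ≤ S t p * ((∑ q, γ p q) * ∑ q, (min (I t q) 0)^2) := mul_le_mul_of_nonneg_left h2 hs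
      _ ≤ KS p * ((∑ q, γ p q) * ∑ q, (min (I t q) 0)^2) := mul_le_mul_of_nonneg_right h1 h5
      _ = _ := by ring
  have hSa : ∀ p, AntitoneOn (fun s => S s p) (Set.Icc 0 t_f) := by
    intro p
    refine antitoneOn_of_hasDerivWithinAt_nonpos (convex_Icc 0 t_f) (hSc p)
      (fun t ht => (hSode p t (interior_subset ht)).mono interior_subset) ?_
    intro t ht
    have ht' := interior_subset ht
    have hT : 0 ≤ gridT γ (I t) p :=
      Finset.sum_nonneg fun q _ => mul_nonneg (hγ p q) (hI q t ht')
    have := mul_nonneg (hS p t ht') hT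
    have := mul_nonneg hc (hS p t ht')
    linarith
  have hRm : ∀ p, MonotoneOn (fun s => R s p) (Set.Icc 0 t_f) := by
    intro p
    refine monotoneOn_of_hasDerivWithinAt_nonneg (convex_Icc 0 t_f)
      (fun t ht => (hRode p t ht).continuousWithinAt)
      (fun t ht => (hRode p t (interior_subset ht)).mono interior_subset) ?_
    intro t ht
    have ht' := interior_subset ht
    have := mul_nonneg hb.le (hI p t ht')
    have := mul_nonneg hc (hS p t ht')
    linarith
  intro p t ht
  refine ⟨⟨hS p t ht, hI p t ht, (hR0 p).trans (hRm p z ht ht.1)⟩, ?_,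
    fun t' ht' h => ⟨hSa p ht' ht h, hRm p ht' ht h⟩⟩
  have hN : ∀ t ∈ Set.Icc (0:ℝ) t_f,
      HasDerivWithinAt (fun s => S s p + I s p + R s p) 0 (Set.Icc 0 t_f) t := by
    intro t ht
    refine (((hSode p t ht).add (hIode p t ht)).add (hRode p t ht)).congr_deriv ?_
    ring
  have a1 := antitoneOn_of_hasDerivWithinAt_nonpos (convex_Icc 0 t_f)
    (fun t ht => (hN t ht).continuousWithinAt)
    (fun t ht => (hN t (interior_subset ht)).mono interior_subset) (fun _ _ => le_rfl)
  have a2 := monotoneOn_of_hasDerivWithinAt_nonneg (convex_Icc 0 t_f)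
    (fun t ht => (hN t ht).continuousWithinAt)
    (fun t ht => (hN t (interior_subset ht)).mono interior_subset) (fun _ _ => le_rfl)
  exact le_antisymm (a1 z ht ht.1) (a2 z ht ht.1)
end

section
/- Uniqueness for the semi-discretized SIR system: let t_f > 0 and suppose (S, I, R) and (S̃, Ĩ, R̃) are two differentiable triples of functions [0, t_f] → (P → ℝ) satisfying, for every p ∈ P and t ∈ [0, t_f], S_p′ = −S_p·(T I)(p) − c·S_p, I_p′ = S_p·(T I)(p) − b·I_p, R_p′ = b·I_p + c·S_p (and the analogous equations for the tilde triple), with the same initial data at t = 0. Then the two solutions coincide on [0, t_f]. -/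
/-- Uniqueness for the semi-discretized SIR system: two differentiable solution triples
with the same initial data coincide on `[0, t_f]`. -/
theorem semidiscrete_SIR_uniqueness
    {P : Type*} [Fintype P] [Nonempty P]
    (γ : P → P → ℝ) (hγ : ∀ p q, 0 ≤ γ p q)
    (b c : ℝ) (hb : 0 < b) (hc : 0 ≤ c)
    (t_f : ℝ) (htf : 0 < t_f)
    (S I R S' I' R' : ℝ → P → ℝ)
    (hSode : ∀ p, ∀ t ∈ Set.Icc (0 : ℝ) t_f,
      HasDerivWithinAt (fun s => S s p) (-(S t p * gridT γ (I t) p) - c * S t p)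
        (Set.Icc 0 t_f) t)
    (hIode : ∀ p, ∀ t ∈ Set.Icc (0 : ℝ) t_f,
      HasDerivWithinAt (fun s => I s p) (S t p * gridT γ (I t) p - b * I t p)
        (Set.Icc 0 t_f) t)
    (hRode : ∀ p, ∀ t ∈ Set.Icc (0 : ℝ) t_f,
      HasDerivWithinAt (fun s => R s p) (b * I t p + c * S t p) (Set.Icc 0 t_f) t)
    (hSode' : ∀ p, ∀ t ∈ Set.Icc (0 : ℝ) t_f,
      HasDerivWithinAt (fun s => S' s p) (-(S' t p * gridT γ (I' t) p) - c * S' t p)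
        (Set.Icc 0 t_f) t)
    (hIode' : ∀ p, ∀ t ∈ Set.Icc (0 : ℝ) t_f,
      HasDerivWithinAt (fun s => I' s p) (S' t p * gridT γ (I' t) p - b * I' t p)
        (Set.Icc 0 t_f) t)
    (hRode' : ∀ p, ∀ t ∈ Set.Icc (0 : ℝ) t_f,
      HasDerivWithinAt (fun s => R' s p) (b * I' t p + c * S' t p) (Set.Icc 0 t_f) t)
    (hS0 : S 0 = S' 0) (hI0 : I 0 = I' 0) (hR0 : R 0 = R' 0) :
    ∀ t ∈ Set.Icc (0 : ℝ) t_f, S t = S' t ∧ I t = I' t ∧ R t = R' t := by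
  let v : (P → ℝ) × (P → ℝ) × (P → ℝ) → (P → ℝ) × (P → ℝ) × (P → ℝ) := fun x =>
    (fun p => -(x.1 p * gridT γ x.2.1 p) - c * x.1 p,
     fun p => x.1 p * gridT γ x.2.1 p - b * x.2.1 p,
     fun p => b * x.2.1 p + c * x.1 p)
  have hv : ContDiff ℝ 1 v := by
    simp only [v, gridT]
    fun_prop
  have key : ∀ A B C : ℝ → P → ℝ,
      (∀ p, ∀ t ∈ Set.Icc (0 : ℝ) t_f,
      HasDerivWithinAt (fun s => A s p) (-(A t p * gridT γ (B t) p) - c * A t p)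
        (Set.Icc 0 t_f) t) →
      (∀ p, ∀ t ∈ Set.Icc (0 : ℝ) t_f,
      HasDerivWithinAt (fun s => B s p) (A t p * gridT γ (B t) p - b * B t p)
        (Set.Icc 0 t_f) t) →
      (∀ p, ∀ t ∈ Set.Icc (0 : ℝ) t_f,
      HasDerivWithinAt (fun s => C s p) (b * B t p + c * A t p) (Set.Icc 0 t_f) t) →
      ∀ t ∈ Set.Icc (0 : ℝ) t_f, HasDerivWithinAt (fun s => (A s, B s, C s))
        (v (A t, B t, C t)) (Set.Icc 0 t_f) t := by
    intro A B C h1 h2 h3 t ht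
    exact (hasDerivWithinAt_pi.2 fun p => h1 p t ht).prodMk
      ((hasDerivWithinAt_pi.2 fun p => h2 p t ht).prodMk
        (hasDerivWithinAt_pi.2 fun p => h3 p t ht))
  have hf := key S I R hSode hIode hRode
  have hg := key S' I' R' hSode' hIode' hRode'
  have hfc : ContinuousOn (fun s => (S s, I s, R s)) (Set.Icc 0 t_f) :=
    fun t ht => (hf t ht).continuousWithinAt
  have hgc : ContinuousOn (fun s => (S' s, I' s, R' s)) (Set.Icc 0 t_f) :=
    fun t ht => (hg t ht).continuousWithinAt
  have hK := (isCompact_Icc.image_of_continuousOn hfc).union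
    (isCompact_Icc.image_of_continuousOn hgc)
  obtain ⟨r, hr⟩ := hK.isBounded.subset_closedBall 0
  obtain ⟨K, hKl⟩ := hv.contDiffOn.exists_lipschitzOnWith (s := Metric.closedBall 0 r) one_ne_zero
    (convex_closedBall 0 r) (isCompact_closedBall 0 r)
  have hmono : ∀ t ∈ Set.Ico (0:ℝ) t_f, Set.Icc 0 t_f ∈ nhdsWithin t (Set.Ici t) := by
    intro t ht
    exact Filter.mem_of_superset (Icc_mem_nhdsGE ht.2) (Set.Icc_subset_Icc_left ht.1)
  have := ODE_solution_unique_of_mem_Icc_right (v := fun _ => v) (a := 0) (b := t_f)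
    (s := fun _ => Metric.closedBall 0 r) (K := K) (fun _ _ => hKl) hfc
    (fun t ht => (hf t (Set.Ico_subset_Icc_self ht)).mono_of_mem_nhdsWithin (hmono t ht))
    (fun t ht => hr (Or.inl ⟨t, Set.Ico_subset_Icc_self ht, rfl⟩)) hgc
    (fun t ht => (hg t (Set.Ico_subset_Icc_self ht)).mono_of_mem_nhdsWithin (hmono t ht))
    (fun t ht => hr (Or.inr ⟨t, Set.Ico_subset_Icc_self ht, rfl⟩))
    (by simp [hS0, hI0, hR0])
  intro t ht
  simpa using this ht
end

section
/- Forward Euler with adaptive step sizes preserves the discrete qualitative properties: let S⁰, I⁰, R⁰ : P → ℝ be nonnegative, let (τ_n)_{n≥1} be positive step sizes, and define for n ≥ 1 and each p ∈ P: Sⁿ(p) = Sⁿ⁻¹(p) − τ_n·Sⁿ⁻¹(p)·(T Iⁿ⁻¹)(p) − c·τ_n·Sⁿ⁻¹(p), Iⁿ(p) = Iⁿ⁻¹(p) + τ_n·Sⁿ⁻¹(p)·(T Iⁿ⁻¹)(p) − b·τ_n·Iⁿ⁻¹(p), Rⁿ(p) = Rⁿ⁻¹(p) + b·τ_n·Iⁿ⁻¹(p)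 + c·τ_n·Sⁿ⁻¹(p). If for every n ≥ 1 one has τ_n·b ≤ 1 and τ_n·((T Iⁿ⁻¹)(p) + c) ≤ 1 for all p ∈ P, then for every n ≥ 1 and p ∈ P: (D₁) Sⁿ(p), Iⁿ(p), Rⁿ(p) ≥ 0; (D₂) Sⁿ(p) + Iⁿ(p) + Rⁿ(p) = S⁰(p) + I⁰(p) + R⁰(p); (D₃) Sⁿ(p) ≤ Sⁿ⁻¹(p); (D₄) Rⁿ(p) ≥ Rⁿ⁻¹(p). -/
/-- The forward Euler method with adaptive step sizes `τ_n` satisfying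
`τ_n·b ≤ 1` and `τ_n·((T Iⁿ⁻¹)(p) + c) ≤ 1` preserves the discrete qualitative
properties (D₁)–(D₄) of the semi-discretized SIR system. -/
theorem forward_euler_adaptive_qualitative
    {P : Type*} [Fintype P] [Nonempty P]
    (γ : P → P → ℝ) (hγ : ∀ p q, 0 ≤ γ p q)
    (b c : ℝ) (hb : 0 < b) (hc : 0 ≤ c)
    (τ : ℕ → ℝ) (hτpos : ∀ n, 0 < τ n)
    (S I R : ℕ → P → ℝ)
    (hS0 : ∀ p, 0 ≤ S 0 p) (hI0 : ∀ p, 0 ≤ I 0 p) (hR0 : ∀ p, 0 ≤ R 0 p)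
    (hSrec : ∀ n p, S (n + 1) p =
      S n p - τ n * S n p * gridT γ (I n) p - c * τ n * S n p)
    (hIrec : ∀ n p, I (n + 1) p =
      I n p + τ n * S n p * gridT γ (I n) p - b * τ n * I n p)
    (hRrec : ∀ n p, R (n + 1) p = R n p + b * τ n * I n p + c * τ n * S n p)
    (hτb : ∀ n, τ n * b ≤ 1)
    (hτT : ∀ n p, τ n * (gridT γ (I n) p + c) ≤ 1) :
    ∀ n p,
      (0 ≤ S n p ∧ 0 ≤ I n p ∧ 0 ≤ R n p) ∧
      S n p + I n p + R n p = S 0 p + I 0 p + R 0 p ∧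
      S (n + 1) p ≤ S n p ∧ R n p ≤ R (n + 1) p := by
  have hT : ∀ n, (∀ p, 0 ≤ I n p) → ∀ p, 0 ≤ gridT γ (I n) p := fun n h p =>
    Finset.sum_nonneg fun q _ => mul_nonneg (hγ p q) (h q)
  have key : ∀ n, (∀ p, 0 ≤ S n p) ∧ (∀ p, 0 ≤ I n p) ∧ (∀ p, 0 ≤ R n p) ∧
      (∀ p, S n p + I n p + R n p = S 0 p + I 0 p + R 0 p) := by
    intro n
    induction n with
    | zero => exact ⟨hS0, hI0, hR0, fun _ => rfl⟩
    | succ n ih =>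
      obtain ⟨hS, hI, hR, hE⟩ := ih
      have ht := (hτpos n).le
      refine ⟨fun p => ?_, fun p => ?_, fun p => ?_, fun p => ?_⟩
      · rw [hSrec]
        have := mul_nonneg (hS p) (sub_nonneg.2 (hτT n p))
        linarith
      · rw [hIrec]
        have h1 := mul_nonneg (hI p) (sub_nonneg.2 (hτb n))
        have h2 := mul_nonneg (mul_nonneg ht (hS p)) (hT n hI p)
        linarith
      · rw [hRrec]
        have h1 := mul_nonneg (mul_nonneg hb.le ht) (hI p)
        have h2 := mul_nonneg (mul_nonneg hc ht) (hS p)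
        linarith [hR p]
      · rw [hSrec, hIrec, hRrec, ← hE p]
        ring
  intro n p
  obtain ⟨hS, hI, hR, hE⟩ := key n
  have ht := (hτpos n).le
  have h1 := mul_nonneg (mul_nonneg hb.le ht) (hI p)
  have h2 := mul_nonneg (mul_nonneg hc ht) (hS p)
  have h3 := mul_nonneg (mul_nonneg ht (hS p)) (hT n hI p)
  refine ⟨⟨hS p, hI p, hR p⟩, hE p, ?_, ?_⟩
  · rw [hSrec]
    linarith
  · rw [hRrec]
    linarith
end

section
/- Forward Euler with the improved constant step size preserves the discrete qualitative properties: let S⁰, I⁰, R⁰ : P → ℝ be nonnegative, set m̃ = max_{p∈P} (S⁰(p) + I⁰(p) + R⁰(p)) and T̃ = m̃ · max_{p∈P} Σ_{q∈P} γ(p,q), and let τ > 0 satisfy τ·b ≤ 1 and τ·(T̃ + c) ≤ 1. Define for n ≥ 1 and each p ∈ P: Sⁿ(p) = Sⁿ⁻¹(p) − τ·Sⁿ⁻¹(p)·(T Iⁿ⁻¹)(p) − c·τ·Sⁿ⁻¹(p), Iⁿ(p) = Iⁿ⁻¹(p) + τ·Sⁿ⁻¹(p)·(T Iⁿ⁻¹)(p)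 − b·τ·Iⁿ⁻¹(p), Rⁿ(p) = Rⁿ⁻¹(p) + b·τ·Iⁿ⁻¹(p) + c·τ·Sⁿ⁻¹(p). Then for every n ≥ 1 and p ∈ P: Sⁿ(p), Iⁿ(p), Rⁿ(p) ≥ 0; Sⁿ(p) + Iⁿ(p) + Rⁿ(p) = S⁰(p) + I⁰(p) + R⁰(p); Sⁿ(p) ≤ Sⁿ⁻¹(p); and Rⁿ(p) ≥ Rⁿ⁻¹(p). -/
/-- The forward Euler method with the improved constant step size `τ` satisfying
`τ·b ≤ 1` and `τ·(T̃ + c) ≤ 1`, where `T̃ = m̃·max_p Σ_q γ(p,q)` and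
`m̃ = max_p (S⁰(p) + I⁰(p) + R⁰(p))`, preserves the discrete qualitative properties
(D₁)–(D₄) of the semi-discretized SIR system. -/
theorem forward_euler_improved_qualitative
    {P : Type*} [Fintype P] [Nonempty P]
    (γ : P → P → ℝ) (hγ : ∀ p q, 0 ≤ γ p q)
    (b c : ℝ) (hb : 0 < b) (hc : 0 ≤ c)
    (S I R : ℕ → P → ℝ)
    (hS0 : ∀ p, 0 ≤ S 0 p) (hI0 : ∀ p, 0 ≤ I 0 p) (hR0 : ∀ p, 0 ≤ R 0 p)
    (mt Tt : ℝ)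
    (hmt : mt = Finset.univ.sup' Finset.univ_nonempty (fun p => S 0 p + I 0 p + R 0 p))
    (hTt : Tt = mt * Finset.univ.sup' Finset.univ_nonempty (fun p => ∑ q, γ p q))
    (τ : ℝ) (hτpos : 0 < τ) (hτb : τ * b ≤ 1) (hτT : τ * (Tt + c) ≤ 1)
    (hSrec : ∀ n p, S (n + 1) p =
      S n p - τ * S n p * gridT γ (I n) p - c * τ * S n p)
    (hIrec : ∀ n p, I (n + 1) p =
      I n p + τ * S n p * gridT γ (I n) p - b * τ * I n p)
    (hRrec : ∀ n p, R (n + 1) p = R n p + b * τ * I n p + c * τ * S n p) :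
    ∀ n p,
      (0 ≤ S n p ∧ 0 ≤ I n p ∧ 0 ≤ R n p) ∧
      S n p + I n p + R n p = S 0 p + I 0 p + R 0 p ∧
      S (n + 1) p ≤ S n p ∧ R n p ≤ R (n + 1) p := by
  have hm : ∀ p, S 0 p + I 0 p + R 0 p ≤ mt := fun p => by
    rw [hmt]
    exact Finset.le_sup' (fun p => S 0 p + I 0 p + R 0 p) (Finset.mem_univ p)
  have hm0 : 0 ≤ mt := by
    obtain ⟨p⟩ := ‹Nonempty P›
    linarith [hm p, hS0 p, hI0 p, hR0 p]
  have hG : ∀ p, mt * ∑ q, γ p q ≤ Tt := fun p => by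
    rw [hTt]
    exact mul_le_mul_of_nonneg_left
      (Finset.le_sup' (fun p => ∑ q, γ p q) (Finset.mem_univ p)) hm0
  have hT0 : ∀ n, (∀ p, 0 ≤ I n p) → ∀ p, 0 ≤ gridT γ (I n) p := fun n h p =>
    Finset.sum_nonneg fun q _ => mul_nonneg (hγ p q) (h q)
  have key : ∀ n, ∀ p, (0 ≤ S n p ∧ 0 ≤ I n p ∧ 0 ≤ R n p) ∧
      S n p + I n p + R n p = S 0 p + I 0 p + R 0 p := by
    intro n
    induction n with
    | zero => exact fun p => ⟨⟨hS0 p, hI0 p, hR0 p⟩, rfl⟩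
    | succ n ih =>
      intro p
      obtain ⟨⟨hs, hi, hr⟩, hsum⟩ := ih p
      have hT := hT0 n (fun q => (ih q).1.2.1) p
      have hTle : gridT γ (I n) p ≤ Tt := by
        refine le_trans ?_ (hG p)
        rw [Finset.mul_sum]
        refine Finset.sum_le_sum fun q _ => ?_
        rw [mul_comm mt]
        refine mul_le_mul_of_nonneg_left ?_ (hγ p q)
        obtain ⟨⟨h1, h2, h3⟩, h4⟩ := ih q
        linarith [hm q]
      have h1 : τ * (gridT γ (I n) p + c) ≤ 1 :=
        le_trans (mul_le_mul_of_nonneg_left (by linarith) hτpos.le) hτT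
      have h2 : 0 ≤ S n p * (1 - τ * (gridT γ (I n) p + c)) :=
        mul_nonneg hs (by linarith)
      have h3 : 0 ≤ I n p * (1 - τ * b) := mul_nonneg hi (by linarith)
      have h4 : 0 ≤ τ * S n p * gridT γ (I n) p := by positivity
      have h5 : 0 ≤ b * τ * I n p := by positivity
      have h6 : 0 ≤ c * τ * S n p := by positivity
      rw [hSrec, hIrec, hRrec]
      refine ⟨⟨?_, ?_, ?_⟩, ?_⟩ <;> linarith
  intro n p
  obtain ⟨⟨hs, hi, hr⟩, hsum⟩ := key n p
  have hT := hT0 n (fun q => (key n q).1.2.1) p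
  have h4 : 0 ≤ τ * S n p * gridT γ (I n) p := by positivity
  have h5 : 0 ≤ b * τ * I n p := by positivity
  have h6 : 0 ≤ c * τ * S n p := by positivity
  rw [hSrec, hRrec]
  exact ⟨⟨hs, hi, hr⟩, hsum, by linarith, by linarith⟩
end

section
/- Explicit SSP Runge–Kutta methods preserve the discrete qualitative properties of the semi-discretized SIR system under the SSP step-size restriction: let m ≥ 1 and let the Shu–Osher coefficients satisfy α_{ij} ≥ 0 (for 1 ≤ j < i ≤ m+1), v_i ≥ 0, and v_i + Σ_{j<i} α_{ij} = 1 for each 1 ≤ i ≤ m+1, with SSP coefficient 𝒞 > 0. Let S⁰, I⁰, R⁰ : P → ℝ be nonnegative, set m̃ = max_{p∈P}(S⁰(p)+I⁰(p)+R⁰(p)) and T̃ = m̃·max_{p∈P} Σ_{q∈P} γ(p,q), and let τ > 0 satisfy τ·b ≤ 𝒞 and τ·(T̃ + c) ≤ 𝒞. Define the n-th step from the (n−1)-th by the stage recursion: for i = 1,…,m+1 and each p ∈ P, S^{(i)}(p) = v_i·Sⁿ⁻¹(p) + Σ_{j<i} α_{ij}·(S^{(j)}(p) − (τ/𝒞)·(S^{(j)}(p)·(T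 I^{(j)})(p) + c·S^{(j)}(p))), I^{(i)}(p) = v_i·Iⁿ⁻¹(p) + Σ_{j<i} α_{ij}·(I^{(j)}(p) + (τ/𝒞)·(S^{(j)}(p)·(T I^{(j)})(p) − b·I^{(j)}(p))), R^{(i)}(p) = v_i·Rⁿ⁻¹(p) + Σ_{j<i} α_{ij}·(R^{(j)}(p) + (τ/𝒞)·(b·I^{(j)}(p) + c·S^{(j)}(p))), and Sⁿ = S^{(m+1)}, Iⁿ = I^{(m+1)}, Rⁿ = R^{(m+1)}. Then for every n ≥ 1 and p ∈ P: (D₁) Sⁿ(p), Iⁿ(p), Rⁿ(p) ≥ 0; (D₂) Sⁿ(p) + Iⁿ(p) + Rⁿ(p) = S⁰(p) + I⁰(p) + R⁰(p); (D₃) Sⁿ(p) ≤ Sⁿ⁻¹(p); (D₄) Rⁿ(p) ≥ Rⁿ⁻¹(p). -/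
/-- Explicit SSP Runge–Kutta methods in canonical Shu–Osher form with SSP coefficient
`𝒞 > 0` preserve the discrete qualitative properties (D₁)–(D₄) of the semi-discretized
SIR system under the step-size restriction `τ·b ≤ 𝒞`, `τ·(T̃ + c) ≤ 𝒞`. -/
theorem SSP_RK_qualitative
    {P : Type*} [Fintype P] [Nonempty P]
    (γ : P → P → ℝ) (hγ : ∀ p q, 0 ≤ γ p q)
    (b c : ℝ) (hb : 0 < b) (hc : 0 ≤ c)
    (m : ℕ) (hm : 1 ≤ m)
    (α : ℕ → ℕ → ℝ) (v : ℕ → ℝ)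
    (hα : ∀ i j, 1 ≤ j → j < i → i ≤ m + 1 → 0 ≤ α i j)
    (hv : ∀ i, 1 ≤ i → i ≤ m + 1 → 0 ≤ v i)
    (hconsist : ∀ i, 1 ≤ i → i ≤ m + 1 → v i + ∑ j ∈ Finset.Ico 1 i, α i j = 1)
    (C : ℝ) (hC : 0 < C)
    (S I R : ℕ → P → ℝ) (SS II RR : ℕ → ℕ → P → ℝ)
    (hS0 : ∀ p, 0 ≤ S 0 p) (hI0 : ∀ p, 0 ≤ I 0 p) (hR0 : ∀ p, 0 ≤ R 0 p)
    (mt Tt : ℝ)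
    (hmt : mt = Finset.univ.sup' Finset.univ_nonempty (fun p => S 0 p + I 0 p + R 0 p))
    (hTt : Tt = mt * Finset.univ.sup' Finset.univ_nonempty (fun p => ∑ q, γ p q))
    (τ : ℝ) (hτpos : 0 < τ) (hτb : τ * b ≤ C) (hτT : τ * (Tt + c) ≤ C)
    (hSS : ∀ n i, 1 ≤ i → i ≤ m + 1 → ∀ p, SS n i p =
      v i * S n p + ∑ j ∈ Finset.Ico 1 i,
        α i j * (SS n j p - τ / C * (SS n j p * gridT γ (II n j) p + c * SS n j p)))
    (hII : ∀ n i, 1 ≤ i → i ≤ m + 1 → ∀ p, II n i p =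
      v i * I n p + ∑ j ∈ Finset.Ico 1 i,
        α i j * (II n j p + τ / C * (SS n j p * gridT γ (II n j) p - b * II n j p)))
    (hRR : ∀ n i, 1 ≤ i → i ≤ m + 1 → ∀ p, RR n i p =
      v i * R n p + ∑ j ∈ Finset.Ico 1 i,
        α i j * (RR n j p + τ / C * (b * II n j p + c * SS n j p)))
    (hSstep : ∀ n p, S (n + 1) p = SS n (m + 1) p)
    (hIstep : ∀ n p, I (n + 1) p = II n (m + 1) p)
    (hRstep : ∀ n p, R (n + 1) p = RR n (m + 1) p) :
    ∀ n p,
      (0 ≤ S n p ∧ 0 ≤ I n p ∧ 0 ≤ R n p) ∧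
      S n p + I n p + R n p = S 0 p + I 0 p + R 0 p ∧
      S (n + 1) p ≤ S n p ∧ R n p ≤ R (n + 1) p := by
  have hmtle : ∀ p, S 0 p + I 0 p + R 0 p ≤ mt := by
    intro p
    rw [hmt]
    exact Finset.le_sup' (fun p => S 0 p + I 0 p + R 0 p) (Finset.mem_univ p)
  have hmt0 : 0 ≤ mt := by
    obtain ⟨p⟩ := ‹Nonempty P›
    linarith [hmtle p, hS0 p, hI0 p, hR0 p]
  have hT : ∀ J : P → ℝ, (∀ q, J q ≤ mt) → ∀ p, gridT γ J p ≤ Tt := by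
    intro J hJ p
    have h1 : gridT γ J p ≤ mt * ∑ q, γ p q := by
      unfold gridT
      rw [Finset.mul_sum]
      refine Finset.sum_le_sum fun q _ => ?_
      rw [mul_comm mt]
      exact mul_le_mul_of_nonneg_left (hJ q) (hγ p q)
    have h2 := Finset.le_sup' (fun p => ∑ q, γ p q) (Finset.mem_univ p)
    rw [hTt]
    exact h1.trans (mul_le_mul_of_nonneg_left h2 hmt0)
  have hT0 : ∀ J : P → ℝ, (∀ q, 0 ≤ J q) → ∀ p, 0 ≤ gridT γ J p := by
    intro J hJ p
    exact Finset.sum_nonneg fun q _ => mul_nonneg (hγ p q) (hJ q)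
  obtain ⟨h, hh⟩ : ∃ h, h = τ / C := ⟨_, rfl⟩
  have hpos : 0 ≤ h := by rw [hh]; positivity
  have hhb : h * b ≤ 1 := by
    rw [hh, div_mul_eq_mul_div, div_le_one hC]; exact hτb
  have hhT : h * (Tt + c) ≤ 1 := by
    rw [hh, div_mul_eq_mul_div, div_le_one hC]; exact hτT
  simp only [← hh] at hSS hII hRR
  have stage : ∀ n, (∀ p, (0 ≤ S n p ∧ 0 ≤ I n p ∧ 0 ≤ R n p) ∧
      S n p + I n p + R n p = S 0 p + I 0 p + R 0 p) →
      ∀ i, 1 ≤ i → i ≤ m + 1 → ∀ p, (0 ≤ SS n i p ∧ 0 ≤ II n i p ∧ 0 ≤ RR n i p) ∧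
      SS n i p + II n i p + RR n i p = S 0 p + I 0 p + R 0 p ∧
      SS n i p ≤ S n p ∧ R n p ≤ RR n i p := by
    intro n hn i
    induction i using Nat.strong_induction_on with
    | _ i ih =>
    intro hi1 him p
    have key : ∀ j ∈ Finset.Ico 1 i,
        0 ≤ α i j ∧
        0 ≤ SS n j p - h * (SS n j p * gridT γ (II n j) p + c * SS n j p) ∧
        0 ≤ II n j p + h * (SS n j p * gridT γ (II n j) p - b * II n j p) ∧
        SS n j p - h * (SS n j p * gridT γ (II n j) p + c * SS n j p) ≤ S n p ∧
        R n p ≤ RR n j p + h * (b * II n j p + c * SS n j p) ∧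
        SS n j p + II n j p + RR n j p = S 0 p + I 0 p + R 0 p := by
      intro j hj
      obtain ⟨hj1, hji⟩ := Finset.mem_Ico.mp hj
      have hjm : j ≤ m + 1 := by omega
      have H := ih j hji hj1 hjm
      obtain ⟨⟨a1, a2, a3⟩, a4, a5, a6⟩ := H p
      have t0 := hT0 (II n j) (fun q => (H q).1.2.1) p
      have t1 := hT (II n j) (fun q => by
        obtain ⟨⟨b1, b2, b3⟩, b4, -, -⟩ := H q
        linarith [hmtle q]) p
      have e1 : h * (gridT γ (II n j) p + c) ≤ 1 :=
        (mul_le_mul_of_nonneg_left (by linarith) hpos).trans hhT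
      have e2 := mul_nonneg a1 (sub_nonneg.mpr e1)
      have e3 := mul_nonneg a2 (sub_nonneg.mpr hhb)
      have e4 := mul_nonneg hpos (mul_nonneg a1 t0)
      have e5 := mul_nonneg hpos (mul_nonneg hc a1)
      have e6 := mul_nonneg hpos (mul_nonneg hb.le a2)
      refine ⟨hα i j hj1 hji him, ?_, ?_, ?_, ?_, a4⟩
      · linarith
      · linarith
      · linarith
      · linarith
    obtain ⟨⟨s0, i0, r0⟩, hsum⟩ := hn p
    have hv' := hv i hi1 him
    have hcon := hconsist i hi1 him
    have cS : ∀ x : ℝ, x = v i * x + ∑ j ∈ Finset.Ico 1 i, α i j * x := by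
      intro x
      rw [← Finset.sum_mul, ← add_mul, hcon, one_mul]
    have hR : R n p ≤ RR n i p := by
      rw [hRR n i hi1 him p]
      refine (cS (R n p)).le.trans (add_le_add le_rfl (Finset.sum_le_sum fun j hj => ?_))
      obtain ⟨k0, k1, k2, k3, k4, k5⟩ := key j hj
      exact mul_le_mul_of_nonneg_left k4 k0
    refine ⟨⟨?_, ?_, r0.trans hR⟩, ?_, ?_, hR⟩
    · rw [hSS n i hi1 him p]
      refine add_nonneg (mul_nonneg hv' s0) (Finset.sum_nonneg fun j hj => ?_)
      obtain ⟨k0, k1, k2, k3, k4, k5⟩ := key j hj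
      exact mul_nonneg k0 k1
    · rw [hII n i hi1 him p]
      refine add_nonneg (mul_nonneg hv' i0) (Finset.sum_nonneg fun j hj => ?_)
      obtain ⟨k0, k1, k2, k3, k4, k5⟩ := key j hj
      exact mul_nonneg k0 k2
    · rw [cS (S 0 p + I 0 p + R 0 p), hSS n i hi1 him p, hII n i hi1 him p, hRR n i hi1 him p]
      have : ∑ j ∈ Finset.Ico 1 i, α i j * (S 0 p + I 0 p + R 0 p) =
          ∑ j ∈ Finset.Ico 1 i,
            α i j * (SS n j p - h * (SS n j p * gridT γ (II n j) p + c * SS n j p)) +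
          ∑ j ∈ Finset.Ico 1 i,
            α i j * (II n j p + h * (SS n j p * gridT γ (II n j) p - b * II n j p)) +
          ∑ j ∈ Finset.Ico 1 i,
            α i j * (RR n j p + h * (b * II n j p + c * SS n j p)) := by
        rw [← Finset.sum_add_distrib, ← Finset.sum_add_distrib]
        refine Finset.sum_congr rfl fun j hj => ?_
        obtain ⟨k0, k1, k2, k3, k4, k5⟩ := key j hj
        rw [← k5]
        ring
      rw [this, ← hsum]
      ring
    · rw [hSS n i hi1 him p]
      refine le_trans (add_le_add le_rfl (Finset.sum_le_sum fun j hj => ?_)) (cS (S n p)).ge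
      obtain ⟨k0, k1, k2, k3, k4, k5⟩ := key j hj
      exact mul_le_mul_of_nonneg_left k3 k0
  have inv : ∀ n, ∀ p, (0 ≤ S n p ∧ 0 ≤ I n p ∧ 0 ≤ R n p) ∧
      S n p + I n p + R n p = S 0 p + I 0 p + R 0 p := by
    intro n
    induction n with
    | zero => exact fun p => ⟨⟨hS0 p, hI0 p, hR0 p⟩, rfl⟩
    | succ n ihn =>
      intro p
      have H := stage n ihn (m + 1) (by omega) le_rfl p
      rw [hSstep, hIstep, hRstep]
      exact ⟨H.1, H.2.1⟩
  intro n p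
  have H := stage n (inv n) (m + 1) (by omega) le_rfl p
  refine ⟨(inv n p).1, (inv n p).2, ?_, ?_⟩
  · rw [hSstep]; exact H.2.2.1
  · rw [hRstep]; exact H.2.2.2
end
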